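/- (Center criterion, polynomial form.) An element a ∈ X determines a center if and only if for every i ≥ 1 the polynomial ∑_{i_1+⋯+i_k=i} p_{i_1,…,i_k} · I_{i_1,…,i_k}(a) is identically zero in ℂ[t], where the sum is over all multi-indices of positive integers with i_1+⋯+i_k=i. -/

import Mathlib

open MeasureTheory

noncomputable section

/-- The class `X`: sequences `a = (a₁, a₂, …)` of bounded measurable functions on `[0,T]`
with `sup_{x,i} |aᵢ(x)|^{1/i} < ∞` (equivalently `‖aᵢ(x)‖ ≤ Cⁱ` for some `C`).
We index by `ℕ`, using only indices `i ≥ 1`. -/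
def MemX (T : ℝ) (a : ℕ → ℝ → ℂ) : Prop :=
  (∀ i, Measurable (a i)) ∧
    ∃ C : ℝ, ∀ i : ℕ, 1 ≤ i → ∀ x ∈ Set.Icc (0 : ℝ) T, ‖a i x‖ ≤ C ^ i

/-- Auxiliary iterated integral: for the multi-index list `[j₁, …, jₖ]` (outermost first),
`itIntAux a [j₁,…,jₖ] x = ∫_{0 ≤ s_k ≤ … ≤ s_1 ≤ x} a_{j₁}(s₁)⋯a_{jₖ}(sₖ) ds`. -/
def itIntAux (a : ℕ → ℝ → ℂ) : List ℕ → ℝ → ℂ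
  | [], _ => 1
  | i :: l, x => ∫ s in (0 : ℝ)..x, a i s * itIntAux a l s

/-- The basic iterated integral `I_{i₁,…,iₖ}(a)` over `0 ≤ s₁ ≤ ⋯ ≤ sₖ ≤ T`,
with the multi-index encoded as the list `[i₁, …, iₖ]` (so the empty list gives `1`). -/
def itInt (T : ℝ) (a : ℕ → ℝ → ℂ) (l : List ℕ) : ℂ :=
  itIntAux a l.reverse T

/-- `v` is a Lipschitz solution on `[0,T]` of `v' = ∑_{i≥1} aᵢ(x) v^{i+1}`. -/
def IsODESol (T : ℝ) (a : ℕ → ℝ → ℂ) (v : ℝ → ℂ) : Prop :=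
  (∃ K : NNReal, LipschitzOnWith K v (Set.Icc 0 T)) ∧
    ∀ᵐ x ∂(volume.restrict (Set.Icc (0 : ℝ) T)),
      (Summable fun i : ℕ => ‖a (i + 1) x * v x ^ (i + 2)‖) ∧
        HasDerivAt v (∑' i : ℕ, a (i + 1) x * v x ^ (i + 2)) x


/-- The polynomial `p_{i₁,…,iₖ} = (t-i₁+1)(t-i₁-i₂+1)⋯(t-i₁-⋯-iₖ+1) ∈ ℂ[t]` for the
multi-index `l = [i₁,…,iₖ]`. -/
def pPoly (l : List ℕ) : Polynomial ℂ :=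
  ∏ j ∈ Finset.range l.length,
    (Polynomial.X - Polynomial.C (((l.take (j + 1)).sum : ℕ) : ℂ) + 1)

/-- `a ∈ X` determines a center: there is `ε > 0` such that every Lipschitz solution `v` of
`v' = ∑_{i≥1} aᵢ(x) v^{i+1}` on `[0,T]` with `|v(0)| < ε` satisfies `v(T) = v(0)`. -/
def IsCenter (T : ℝ) (a : ℕ → ℝ → ℂ) : Prop :=
  ∃ ε > (0 : ℝ), ∀ v : ℝ → ℂ, ‖v 0‖ < ε → IsODESol T a v → v T = v 0

open Finset.HasAntidiagonal (antidiagonal)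

def cW (s : ℕ) : List ℕ → ℂ
  | [] => 1
  | j :: m => (s : ℂ) * cW (s + j) m

lemma pPoly_append (m : List ℕ) (j : ℕ) :
    pPoly (m ++ [j]) = pPoly m *
      (Polynomial.X - Polynomial.C (((m.sum + j : ℕ)) : ℂ) + 1) := by
  unfold pPoly
  rw [List.length_append, List.length_singleton, Finset.prod_range_succ]
  congr 1
  · refine Finset.prod_congr rfl fun k hk => ?_
    rw [Finset.mem_range] at hk
    rw [List.take_append_of_le_length (by omega)]
  · rw [List.take_of_length_le (by simp)]
    simp

lemma pPoly_eval (m : List ℕ) (s : ℕ) :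
    (pPoly m.reverse).eval ((s : ℂ) + m.sum - 1) = cW s m := by
  induction m generalizing s with
  | nil => simp [pPoly, cW]
  | cons j m ih =>
    rw [List.reverse_cons, pPoly_append, Polynomial.eval_mul, cW, ← ih (s + j)]
    simp only [List.sum_cons, List.sum_reverse, Polynomial.eval_add, Polynomial.eval_sub,
      Polynomial.eval_X, Polynomial.eval_C, Polynomial.eval_one]
    push_cast
    rw [mul_comm]
    congr 1
    · ring
    · congr 1
      ring

def sumC (n : ℕ) (f : List ℕ → ℂ) : ℂ := ∑ c : Composition n, f c.blocks

lemma sumC_zero (f : List ℕ → ℂ) : sumC 0 f = f [] := by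
  unfold sumC
  rw [Fintype.sum_eq_single (⟨[], by simp, rfl⟩ : Composition 0)]
  intro c hc
  refine absurd (Composition.ext ?_) hc
  obtain ⟨l, hp, hs⟩ := c
  cases l with
  | nil => rfl
  | cons j l =>
    have hj := hp (i := j) (by simp)
    simp at hs
    omega

lemma sumC_succ (n : ℕ) (f : List ℕ → ℂ) :
    sumC (n + 1) f = ∑ p ∈ antidiagonal n, sumC p.2 (fun l => f ((p.1 + 1) :: l)) := by
  unfold sumC
  rw [Finset.sum_sigma']
  symm
  refine Finset.sum_bij (fun x hx => (⟨(x.1.1 + 1) :: x.2.blocks, ?_, ?_⟩ : Composition (n+1)))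
    ?_ ?_ ?_ ?_
  · intro i hi
    rcases List.mem_cons.1 hi with h | h
    · omega
    · exact x.2.blocks_pos h
  · simp only [Finset.mem_sigma, Finset.HasAntidiagonal.mem_antidiagonal] at hx
    rw [List.sum_cons, x.2.blocks_sum]
    omega
  · simp
  · rintro ⟨⟨i, m⟩, c⟩ h ⟨⟨i', m'⟩, c'⟩ h' e
    simp only [Finset.mem_sigma, Finset.HasAntidiagonal.mem_antidiagonal, Finset.mem_univ, and_true] at h h'
    simp only [Composition.mk.injEq, List.cons.injEq, add_left_inj] at e
    obtain ⟨rfl, e⟩ := e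
    obtain rfl : m = m' := by omega
    obtain rfl := Composition.ext e
    rfl
  · rintro ⟨l, hp, hs⟩ -
    cases l with
    | nil => simp at hs
    | cons j l =>
      have hj := hp (i := j) (by simp)
      refine ⟨⟨(j - 1, l.sum), ⟨l, fun hi => hp (List.mem_cons_of_mem _ hi), rfl⟩⟩, ?_, ?_⟩
      · simp at hs ⊢
        omega
      · simp
        omega
  · simp

lemma sumC_reverse (n : ℕ) (f : List ℕ → ℂ) :
    ∑ c : Composition n, f c.blocks.reverse = sumC n f := by
  unfold sumC
  exact Fintype.sum_bijective Composition.reverse Composition.reverse_bijective _ _ (fun c => rfl)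

lemma eval_sum_eq (T : ℝ) (a : ℕ → ℝ → ℂ) (n s : ℕ) :
    (∑ comp : Composition n,
        Polynomial.C (itInt T a comp.blocks) * pPoly comp.blocks).eval ((s : ℂ) + n - 1)
      = sumC n (fun l => cW s l * itIntAux a l T) := by
  rw [← sumC_reverse, Polynomial.eval_finsetSum]
  refine Finset.sum_congr rfl fun c _ => ?_
  rw [Polynomial.eval_mul, Polynomial.eval_C, itInt, mul_comm]
  congr 1
  have := pPoly_eval c.blocks.reverse s
  rw [List.reverse_reverse, List.sum_reverse, c.blocks_sum] at this
  exact this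

lemma poly_zero_of (T : ℝ) (a : ℕ → ℝ → ℂ) (n : ℕ)
    (h : ∀ s : ℕ, 1 ≤ s → sumC n (fun l => cW s l * itIntAux a l T) = 0) :
    ∑ comp : Composition n,
        Polynomial.C (itInt T a comp.blocks) * pPoly comp.blocks = 0 := by
  apply Polynomial.eq_zero_of_infinite_isRoot
  refine Set.Infinite.mono (s := Set.range fun s : ℕ => ((s + 1 : ℕ) : ℂ) + n - 1) ?_ ?_
  · rintro _ ⟨s, rfl⟩
    show Polynomial.eval _ _ = 0
    rw [eval_sum_eq, h _ (by omega)]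
  · refine Set.infinite_range_of_injective fun x y h => ?_
    simpa using h

structure Nice (C : ℝ) (a : ℕ → ℝ → ℂ) : Prop where
  one_le : 1 ≤ C
  meas : ∀ i, Measurable (a i)
  bd : ∀ i x, ‖a i x‖ ≤ C ^ i

lemma Nice.intble {C : ℝ} {a : ℕ → ℝ → ℂ} (h : Nice C a) (i : ℕ) {g : ℝ → ℂ}
    (hg : Continuous g) (x y : ℝ) : IntervalIntegrable (fun t => a i t * g t) volume x y := by
  have h1 : IntervalIntegrable (a i) volume x y := by
    refine IntervalIntegrable.mono_fun (g := a i) (f := fun _ => C ^ i) intervalIntegrable_const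
      (h.meas i).aestronglyMeasurable ?_
    refine Filter.Eventually.of_forall fun t => ?_
    exact (h.bd i t).trans (le_abs_self _)
  exact h1.mul_continuousOn hg.continuousOn

lemma Nice.cont {C : ℝ} {a : ℕ → ℝ → ℂ} (h : Nice C a) (l : List ℕ) :
    Continuous (itIntAux a l) := by
  induction l with
  | nil => exact (continuous_const : Continuous fun _ : ℝ => (1 : ℂ))
  | cons i l ih =>
    exact intervalIntegral.continuous_primitive (fun x y => h.intble i ih x y) 0

def W (a : ℕ → ℝ → ℂ) (n s : ℕ) (x : ℝ) : ℂ := sumC n (fun l => cW s l * itIntAux a l x)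

def DW (a : ℕ → ℝ → ℂ) (n s : ℕ) (x : ℝ) : ℂ :=
  ∑ p ∈ antidiagonal n, a (p.1 + 1) x * W a p.2 (s + (p.1 + 1)) x

lemma Nice.contW {C : ℝ} {a : ℕ → ℝ → ℂ} (h : Nice C a) (n s : ℕ) : Continuous (W a n s) := by
  unfold W sumC
  exact continuous_finsetSum _ fun c _ => continuous_const.mul (h.cont _)

lemma Nice.measDW {C : ℝ} {a : ℕ → ℝ → ℂ} (h : Nice C a) (n s : ℕ) : Measurable (DW a n s) := by
  unfold DW
  exact Finset.measurable_fun_sum _ fun p _ => (h.meas _).mul (h.contW _ _).measurable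

lemma Nice.intDW {C : ℝ} {a : ℕ → ℝ → ℂ} (h : Nice C a) (n s : ℕ) (x y : ℝ) :
    IntervalIntegrable (DW a n s) volume x y := by
  have := IntervalIntegrable.sum (μ := volume) (a := x) (b := y) (antidiagonal n)
    (f := fun p t => a (p.1 + 1) t * W a p.2 (s + (p.1 + 1)) t)
    fun p _ => h.intble _ (h.contW _ _) x y
  convert! this using 1
  ext t
  simp [DW]

lemma W_zero (a : ℕ → ℝ → ℂ) (s : ℕ) (x : ℝ) : W a 0 s x = 1 := by
  simp [W, sumC_zero, cW, itIntAux]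

lemma Nice.W_succ {C : ℝ} {a : ℕ → ℝ → ℂ} (h : Nice C a) (n s : ℕ) (x : ℝ) :
    W a (n + 1) s x = s * ∫ t in (0 : ℝ)..x, DW a n s t := by
  unfold DW
  rw [intervalIntegral.integral_finsetSum fun p _ => h.intble _ (h.contW _ _) _ _,
    W, sumC_succ, Finset.mul_sum]
  refine Finset.sum_congr rfl fun p _ => ?_
  unfold W sumC
  simp_rw [Finset.mul_sum]
  rw [intervalIntegral.integral_finsetSum, Finset.mul_sum]
  · refine Finset.sum_congr rfl fun c _ => ?_
    rw [cW, itIntAux, mul_assoc, ← intervalIntegral.integral_const_mul]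
    congr 2
    ext t
    ring
  · intro c _
    exact h.intble _ (continuous_const.mul (h.cont _)) _ _

lemma W_at_zero {C : ℝ} {a : ℕ → ℝ → ℂ} (h : Nice C a) (n s : ℕ) : W a (n + 1) s 0 = 0 := by
  rw [h.W_succ]; simp

lemma sum_two_pow (n : ℕ) : ∑ p ∈ antidiagonal n, (2 : ℝ) ^ p.2 ≤ 2 ^ (n + 1) := by
  induction n with
  | zero => simp
  | succ n ih =>
    rw [Finset.Nat.sum_antidiagonal_succ]
    simp only
    rw [pow_succ 2 (n + 1)]
    linarith

lemma DW_bound_of {C : ℝ} {a : ℕ → ℝ → ℂ} (h : Nice C a) (n s : ℕ) (x : ℝ)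
    (hW : ∀ m ≤ n, ∀ s : ℕ, ‖W a m s x‖ ≤ (2 * C) ^ m * Real.exp ((s + m : ℕ) * x)) :
    ‖DW a n s x‖ ≤ (2 * C) ^ (n + 1) * Real.exp ((s + (n + 1) : ℕ) * x) := by
  have hC : 0 ≤ C := zero_le_one.trans h.one_le
  unfold DW
  calc _ ≤ ∑ p ∈ antidiagonal n, C ^ (n + 1) * Real.exp ((s + (n + 1) : ℕ) * x) * 2 ^ p.2 := by
        refine norm_sum_le_of_le _ fun p hp => ?_
        have hp' := Finset.HasAntidiagonal.mem_antidiagonal.1 hp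
        rw [norm_mul]
        refine (mul_le_mul (h.bd _ _) (hW p.2 (by omega) _) (norm_nonneg _)
          (pow_nonneg hC _)).trans_eq ?_
        rw [show s + (p.1 + 1) + p.2 = s + (n + 1) by omega,
          show n + 1 = p.1 + 1 + p.2 by omega, mul_pow, pow_add C (p.1 + 1)]
        ring
    _ ≤ _ := by
        rw [← Finset.mul_sum, mul_pow]
        have := sum_two_pow n
        have h2 : 0 ≤ C ^ (n + 1) * Real.exp ((s + (n + 1) : ℕ) * x) := by positivity
        nlinarith [mul_le_mul_of_nonneg_left this h2]

lemma Nice.W_bound {C : ℝ} {a : ℕ → ℝ → ℂ} (h : Nice C a) (n : ℕ) : ∀ (s : ℕ) (x : ℝ), 0 ≤ x →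
    ‖W a n s x‖ ≤ (2 * C) ^ n * Real.exp ((s + n : ℕ) * x) := by
  have hC : 0 ≤ C := zero_le_one.trans h.one_le
  induction n using Nat.strong_induction_on with
  | _ n ih =>
    intro s x hx
    cases n with
    | zero =>
      rw [W_zero]
      simp
      positivity
    | succ n =>
      rw [h.W_succ, norm_mul, Complex.norm_natCast]
      set κ : ℝ := ((s + (n + 1) : ℕ) : ℝ) with hκ
      have hκ0 : 0 < κ := by rw [hκ]; exact_mod_cast (by omega)
      have hsκ : (s : ℝ) ≤ κ := by rw [hκ]; exact_mod_cast (by omega)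
      have h1 : ‖∫ t in (0 : ℝ)..x, DW a n s t‖ ≤
          ∫ t in (0 : ℝ)..x, (2 * C) ^ (n + 1) * Real.exp (κ * t) := by
        refine intervalIntegral.norm_integral_le_of_norm_le hx ?_ ?_
        · refine Filter.Eventually.of_forall fun t ht => ?_
          exact DW_bound_of h n s t fun m hm s => ih m (by omega) s t ht.1.le
        · exact Continuous.intervalIntegrable (by fun_prop) _ _
      have h2 : ∫ t in (0 : ℝ)..x, (2 * C) ^ (n + 1) * Real.exp (κ * t)
          = (2 * C) ^ (n + 1) * (κ⁻¹ * (Real.exp (κ * x) - 1)) := by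
        rw [intervalIntegral.integral_const_mul,
          intervalIntegral.integral_comp_mul_left (fun y => Real.exp y) hκ0.ne']
        simp
      rw [h2] at h1
      have h3 : 0 ≤ Real.exp (κ * x) - 1 := by
        have := Real.one_le_exp (show 0 ≤ κ * x by positivity)
        linarith
      calc _ ≤ κ * ((2 * C) ^ (n + 1) * (κ⁻¹ * (Real.exp (κ * x) - 1))) := by
            refine mul_le_mul hsκ h1 (norm_nonneg _) hκ0.le
        _ = (2 * C) ^ (n + 1) * (Real.exp (κ * x) - 1) := by field_simp
        _ ≤ _ := by
            gcongr
            linarith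

lemma Nice.DW_bound {C : ℝ} {a : ℕ → ℝ → ℂ} (h : Nice C a) (n s : ℕ) (x : ℝ) (hx : 0 ≤ x) :
    ‖DW a n s x‖ ≤ (2 * C) ^ (n + 1) * Real.exp ((s + (n + 1) : ℕ) * x) :=
  DW_bound_of h n s x fun m _ s => h.W_bound m s x hx

/-- primitives of bounded functions -/
lemma prim_lip {T B : ℝ} {g : ℝ → ℂ} (c : ℂ)
    (hi : IntervalIntegrable g volume 0 T)
    (hB : ∀ x ∈ Set.Icc 0 T, ‖g x‖ ≤ B) (hT : 0 ≤ T) :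
    ∃ K : NNReal, LipschitzOnWith K (fun x => c + ∫ t in (0 : ℝ)..x, g t) (Set.Icc 0 T) := by
  have hB0 : 0 ≤ B := (norm_nonneg _).trans (hB 0 ⟨le_rfl, hT⟩)
  refine ⟨⟨B, hB0⟩, LipschitzOnWith.of_dist_le_mul fun x hx y hy => ?_⟩
  have i1 : ∀ z ∈ Set.Icc 0 T, IntervalIntegrable g volume 0 z := fun z hz => by
    refine hi.mono_set ?_
    rw [Set.uIcc_of_le hz.1, Set.uIcc_of_le hT]
    exact Set.Icc_subset_Icc_right hz.2
  rw [dist_add_left, dist_eq_norm, intervalIntegral.integral_interval_sub_left (i1 x hx) (i1 y hy)]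
  refine (intervalIntegral.norm_integral_le_of_norm_le_const fun t ht => hB t ?_).trans_eq
    (b := B * |x - y|) rfl
  have := Set.uIoc_subset_uIcc ht
  exact Set.uIcc_subset_Icc hy hx this

def WD (a : ℕ → ℝ → ℂ) (n s : ℕ) (x : ℝ) : ℂ :=
  match n with
  | 0 => 0
  | n + 1 => s * DW a n s x

lemma Nice.W_ac {C : ℝ} {a : ℕ → ℝ → ℂ} (h : Nice C a) (n s : ℕ) {T : ℝ} (hT : 0 ≤ T) :
    AbsolutelyContinuousOnInterval (W a n s) 0 T := by
  have hC : 0 ≤ C := zero_le_one.trans h.one_le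
  cases n with
  | zero =>
    refine LipschitzOnWith.absolutelyContinuousOnInterval (K := 0) ?_
    refine LipschitzOnWith.of_dist_le_mul fun x hx y hy => ?_
    simp [W_zero]
  | succ n =>
    obtain ⟨K, hK⟩ := prim_lip (T := T) (g := DW a n s) 0 (h.intDW n s 0 T)
      (B := (2 * C) ^ (n + 1) * Real.exp ((s + (n + 1) : ℕ) * T)) (fun x hx => by
        refine (h.DW_bound n s x hx.1).trans ?_
        have := hx.2
        gcongr) hT
    rw [← Set.uIcc_of_le hT] at hK
    have := hK.absolutelyContinuousOnInterval.const_smul (s : ℂ)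
    convert! this using 1
    ext x
    simp [h.W_succ]

lemma Nice.W_deriv {C : ℝ} {a : ℕ → ℝ → ℂ} (h : Nice C a) (n s : ℕ) (T : ℝ) :
    ∀ᵐ x, x ∈ Set.uIcc 0 T → HasDerivAt (W a n s) (WD a n s x) x := by
  cases n with
  | zero =>
    refine Filter.Eventually.of_forall fun x _ => ?_
    have : W a 0 s = fun _ => 1 := by ext x; exact W_zero a s x
    rw [this]
    exact hasDerivAt_const _ _
  | succ n =>
    filter_upwards [(h.intDW n s 0 T).ae_hasDerivAt_integral] with x hx hxT
    have := (hx hxT 0 Set.left_mem_uIcc).const_mul (s : ℂ)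
    convert! this using 1
    ext x
    simp [h.W_succ]

lemma ac_sum {ι : Type*} (S : Finset ι) (f : ι → ℝ → ℂ) (T : ℝ)
    (hf : ∀ i ∈ S, AbsolutelyContinuousOnInterval (f i) 0 T) :
    AbsolutelyContinuousOnInterval (fun x => ∑ i ∈ S, f i x) 0 T := by
  classical
  induction S using Finset.induction_on with
  | empty =>
    refine LipschitzOnWith.absolutelyContinuousOnInterval (K := 0) ?_
    refine LipschitzOnWith.of_dist_le_mul fun x hx y hy => ?_
    simp
  | insert i S hi ih =>
    simp_rw [Finset.sum_insert hi]
    exact (hf i (by simp)).add (ih fun j hj => hf j (by simp [hj]))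

lemma antidiag_assoc (n : ℕ) (f : ℕ → ℕ → ℕ → ℂ) :
    ∑ p ∈ antidiagonal n, ∑ q ∈ antidiagonal p.1, f q.1 q.2 p.2
      = ∑ p ∈ antidiagonal n, ∑ q ∈ antidiagonal p.2, f p.1 q.1 q.2 := by
  rw [Finset.sum_sigma', Finset.sum_sigma']
  refine Finset.sum_nbij' (fun x => ⟨(x.2.1, x.2.2 + x.1.2), (x.2.2, x.1.2)⟩)
    (fun x => ⟨(x.1.1 + x.2.1, x.2.2), (x.1.1, x.2.1)⟩) ?_ ?_ ?_ ?_ ?_ <;>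
  simp +contextual [Finset.mem_sigma, Finset.HasAntidiagonal.mem_antidiagonal] <;> grind

lemma antidiag_swap (n : ℕ) (f : ℕ → ℕ → ℂ) :
    ∑ p ∈ antidiagonal n, f p.1 p.2 = ∑ p ∈ antidiagonal n, f p.2 p.1 :=
  (Finset.Nat.sum_antidiagonal_swap (f := fun p : ℕ × ℕ => f p.2 p.1)).symm ▸ rfl

lemma WD_half (a : ℕ → ℝ → ℂ) (n s s' : ℕ) (x : ℝ)
    (ih : ∀ m ≤ n, ∀ s s' : ℕ,
      ∑ p ∈ antidiagonal m, W a p.1 s x * W a p.2 s' x = W a m (s + s') x) :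
    ∑ p ∈ antidiagonal (n + 1), WD a p.1 s x * W a p.2 s' x = s * DW a n (s + s') x := by
  rw [Finset.Nat.sum_antidiagonal_succ]
  simp only [WD, zero_mul, zero_add]
  have h1 : ∑ p ∈ antidiagonal n, s * DW a p.1 s x * W a p.2 s' x
      = s * ∑ p ∈ antidiagonal n, ∑ q ∈ antidiagonal p.1,
        a (q.1 + 1) x * W a q.2 (s + (q.1 + 1)) x * W a p.2 s' x := by
    rw [Finset.mul_sum]
    refine Finset.sum_congr rfl fun p _ => ?_
    rw [DW, mul_assoc, Finset.sum_mul]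
  rw [h1, antidiag_assoc n (fun j m q => a (j + 1) x * W a m (s + (j + 1)) x * W a q s' x)]
  rw [DW]
  congr 1
  refine Finset.sum_congr rfl fun p hp => ?_
  have hp' := Finset.HasAntidiagonal.mem_antidiagonal.1 hp
  simp_rw [mul_assoc]
  rw [← Finset.mul_sum, ih p.2 (by omega)]
  congr 2
  omega

lemma Nice.W_conv {C : ℝ} {a : ℕ → ℝ → ℂ} (h : Nice C a) (n : ℕ) : ∀ (s s' : ℕ) (x : ℝ),
    0 ≤ x → ∑ p ∈ antidiagonal n, W a p.1 s x * W a p.2 s' x = W a n (s + s') x := by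
  induction n using Nat.strong_induction_on with
  | _ n ih =>
    intro s s' T hT
    cases n with
    | zero => simp [W_zero]
    | succ n =>
      have hac : AbsolutelyContinuousOnInterval (fun x =>
          (∑ p ∈ antidiagonal (n + 1), W a p.1 s x * W a p.2 s' x) - W a (n + 1) (s + s') x) 0 T := by
        refine AbsolutelyContinuousOnInterval.sub (ac_sum _ _ _ fun p _ => ?_) (h.W_ac _ _ hT)
        exact (h.W_ac p.1 s hT).smul (h.W_ac p.2 s' hT)
      obtain ⟨c, hc⟩ := hac.const_of_ae_hasDerivAt_zero (by
        have hall : ∀ᵐ x, ∀ m s : ℕ, x ∈ Set.uIcc 0 T → HasDerivAt (W a m s) (WD a m s x) x := by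
          rw [ae_all_iff]; intro m
          rw [ae_all_iff]; intro s
          exact h.W_deriv m s T
        filter_upwards [hall] with x hx hxT
        have hx0 : 0 ≤ x := by
          rw [Set.uIcc_of_le hT] at hxT; exact hxT.1
        have hd := (HasDerivAt.fun_sum (u := antidiagonal (n + 1)) fun p _ =>
          (hx p.1 s hxT).mul (hx p.2 s' hxT)).sub (hx (n + 1) (s + s') hxT)
        convert! hd using 1
        rw [Finset.sum_add_distrib, WD_half a n s s' x fun m hm s s' => ih m (by omega) s s' x hx0]
        rw [antidiag_swap (n + 1) (fun p q => W a p s x * WD a q s' x)]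
        simp_rw [mul_comm (W a _ s x)]
        rw [WD_half a n s' s x fun m hm s s' => ih m (by omega) s s' x hx0]
        simp only [WD]
        rw [add_comm s' s]
        push_cast
        ring)
      have h0 := hc 0 Set.left_mem_uIcc
      have h1 := hc T Set.right_mem_uIcc
      rw [Finset.sum_eq_zero, W_at_zero h] at h0
      · rw [← h0] at h1
        linear_combination h1
      · rintro ⟨p, q⟩ hp
        have hp' := Finset.HasAntidiagonal.mem_antidiagonal.1 hp
        simp only at hp' ⊢
        cases p with
        | zero =>
          obtain rfl : q = n + 1 := by omega
          rw [W_at_zero h, mul_zero]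
        | succ p => rw [W_at_zero h, zero_mul]

lemma Nice.W_vanish {C : ℝ} {a : ℕ → ℝ → ℂ} (h : Nice C a) {T : ℝ} (hT : 0 ≤ T)
    (h1 : ∀ n, W a (n + 1) 1 T = 0) (s n : ℕ) : W a (n + 1) (s + 1) T = 0 := by
  induction s generalizing n with
  | zero => exact h1 n
  | succ s ih =>
    rw [← h.W_conv (n + 1) (s + 1) 1 T hT]
    refine Finset.sum_eq_zero ?_
    rintro ⟨p, q⟩ hp
    have hp' := Finset.HasAntidiagonal.mem_antidiagonal.1 hp
    simp only at hp' ⊢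
    cases p with
    | zero =>
      obtain rfl : q = n + 1 := by omega
      rw [h1, mul_zero]
    | succ p => rw [ih, zero_mul]

section series
variable {C T : ℝ} {a : ℕ → ℝ → ℂ} {r : ℂ} {x : ℝ}

lemma Nice.term_bound (h : Nice C a) (n s : ℕ) (hx : x ∈ Set.Icc 0 T) :
    ‖W a n s x * r ^ (s + n)‖ ≤ (Real.exp T * ‖r‖) ^ s * (2 * C * (Real.exp T * ‖r‖)) ^ n := by
  have hC : 0 ≤ C := zero_le_one.trans h.one_le
  rw [norm_mul, norm_pow]
  calc _ ≤ ((2 * C) ^ n * Real.exp ((s + n : ℕ) * T)) * ‖r‖ ^ (s + n) := by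
        gcongr
        refine (h.W_bound n s x hx.1).trans ?_
        have := hx.2
        gcongr
    _ = _ := by
        rw [Real.exp_nat_mul]
        ring

lemma Nice.Dterm_bound (h : Nice C a) (n s : ℕ) (hx : x ∈ Set.Icc 0 T) :
    ‖DW a n s x * r ^ (s + (n + 1))‖ ≤
      (Real.exp T * ‖r‖) ^ s * (2 * C * (Real.exp T * ‖r‖)) ^ (n + 1) := by
  have hC : 0 ≤ C := zero_le_one.trans h.one_le
  rw [norm_mul, norm_pow]
  calc _ ≤ ((2 * C) ^ (n + 1) * Real.exp ((s + (n + 1) : ℕ) * T)) * ‖r‖ ^ (s + (n + 1)) := by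
        gcongr
        refine (h.DW_bound n s x hx.1).trans ?_
        have := hx.2
        gcongr
    _ = _ := by
        rw [Real.exp_nat_mul]
        ring

def U (a : ℕ → ℝ → ℂ) (r : ℂ) (x : ℝ) : ℂ := ∑' n, W a n 1 x * r ^ (1 + n)

def SmallR (C T : ℝ) (r : ℂ) : Prop := 2 * C * (Real.exp T * ‖r‖) ≤ 1 / 2

lemma geo_le (h : Nice C a) (hr : SmallR C T r) (n : ℕ) :
    (2 * C * (Real.exp T * ‖r‖)) ^ n ≤ (1 / 2) ^ n := by
  have hC : 0 ≤ C := zero_le_one.trans h.one_le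
  exact pow_le_pow_left₀ (by positivity) hr n

lemma Nice.summ (h : Nice C a) (hr : SmallR C T r) (s : ℕ) (hx : x ∈ Set.Icc 0 T) :
    Summable fun n => ‖W a n s x * r ^ (s + n)‖ := by
  refine Summable.of_nonneg_of_le (fun _ => norm_nonneg _)
    (fun n => (h.term_bound n s hx).trans (mul_le_mul_of_nonneg_left (geo_le h hr n) (by positivity)))
    (Summable.mul_left _ (summable_geometric_of_lt_one (by norm_num) (by norm_num)))

lemma Nice.U_bound (h : Nice C a) (hr : SmallR C T r) (hx : x ∈ Set.Icc 0 T) :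
    ‖U a r x‖ ≤ 2 * (Real.exp T * ‖r‖) := by
  have hs : HasSum (fun n : ℕ => (Real.exp T * ‖r‖) ^ 1 * (1 / 2 : ℝ) ^ n)
      ((Real.exp T * ‖r‖) ^ 1 * 2) :=
    (hasSum_geometric_two).mul_left _
  have := tsum_of_norm_bounded hs (f := fun n => W a n 1 x * r ^ (1 + n))
    (fun n => (h.term_bound n 1 hx).trans
      (mul_le_mul_of_nonneg_left (geo_le h hr n) (by positivity)))
  unfold U
  linarith

lemma Nice.hasSum_pow (h : Nice C a) (hr : SmallR C T r) (hx : x ∈ Set.Icc 0 T) (s : ℕ) :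
    HasSum (fun n => W a n (s + 1) x * r ^ (s + 1 + n)) (U a r x ^ (s + 1)) := by
  induction s with
  | zero =>
    have := (h.summ hr 1 hx).of_norm.hasSum
    simpa [U] using this
  | succ s ih =>
    have h1 := h.summ hr (s + 1) hx
    have h2 := h.summ hr 1 hx
    have key := tsum_mul_tsum_eq_tsum_sum_antidiagonal_of_summable_norm h1 h2
    have e : (fun n => ∑ p ∈ antidiagonal n,
        W a p.1 (s + 1) x * r ^ (s + 1 + p.1) * (W a p.2 1 x * r ^ (1 + p.2)))
        = fun n => W a n (s + 1 + 1) x * r ^ (s + 1 + 1 + n) := by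
      ext n
      rw [← h.W_conv n (s + 1) 1 x hx.1, Finset.sum_mul]
      refine Finset.sum_congr rfl fun p hp => ?_
      have hp' := Finset.HasAntidiagonal.mem_antidiagonal.1 hp
      rw [show s + 1 + 1 + n = (s + 1 + p.1) + (1 + p.2) by omega, pow_add r (s + 1 + p.1)]
      ring
    rw [e] at key
    rw [pow_succ, ← ih.tsum_eq]
    change HasSum _ (_ * U a r x)
    rw [U, key]
    exact (h.summ hr (s + 1 + 1) hx).of_norm.hasSum

/-- right-hand side -/
def RHS (a : ℕ → ℝ → ℂ) (x : ℝ) (v : ℂ) : ℂ := ∑' i : ℕ, a (i + 1) x * v ^ (i + 2)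

lemma Nice.rhs_summ (h : Nice C a) {v : ℂ} (hv : C * ‖v‖ ≤ 1 / 2) :
    Summable fun i : ℕ => ‖a (i + 1) x * v ^ (i + 2)‖ := by
  have hC : 0 ≤ C := zero_le_one.trans h.one_le
  refine Summable.of_nonneg_of_le (fun _ => norm_nonneg _) (fun i => ?_)
    (Summable.mul_left (‖v‖ * (1 / 2)) (summable_geometric_of_lt_one (r := (1 / 2 : ℝ)) (by norm_num) (by norm_num)))
  rw [norm_mul, norm_pow]
  calc _ ≤ C ^ (i + 1) * ‖v‖ ^ (i + 2) := by
        gcongr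
        exact h.bd _ _
    _ = ‖v‖ * (C * ‖v‖) ^ (i + 1) := by ring
    _ ≤ ‖v‖ * (1 / 2) ^ (i + 1) := by gcongr
    _ = _ := by ring

lemma Nice.hasSum_D (h : Nice C a) (hr : SmallR C T r) (hx : x ∈ Set.Icc 0 T) :
    HasSum (fun n => DW a n 1 x * r ^ (1 + (n + 1))) (RHS a x (U a r x)) := by
  have hC : 0 ≤ C := zero_le_one.trans h.one_le
  set z := Real.exp T * ‖r‖ with hz
  have hz0 : 0 ≤ z := by positivity
  let f : ℕ × ℕ → ℂ := fun p => a (p.1 + 1) x * (W a p.2 (1 + (p.1 + 1)) x * r ^ (1 + (p.1 + 1) + p.2))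
  have hf : Summable f := by
    refine Summable.of_norm_bounded (g := fun p : ℕ × ℕ => (z * (1 / 2) * (1 / 2 : ℝ) ^ p.1) * (1 / 2 : ℝ) ^ p.2) ?_ ?_
    · have g1 := summable_geometric_of_lt_one (r := (1 / 2 : ℝ)) (by norm_num) (by norm_num)
      exact Summable.mul_of_nonneg (g1.mul_left (z * (1 / 2))) g1 (fun i => by positivity)
        (fun i => by positivity)
    · intro p
      rw [norm_mul]
      calc _ ≤ C ^ (p.1 + 1) * (z ^ (1 + (p.1 + 1)) * (2 * C * z) ^ p.2) := by
            gcongr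
            · exact h.bd _ _
            · exact h.term_bound _ _ hx
        _ = z * (C * z) ^ (p.1 + 1) * (2 * C * z) ^ p.2 := by ring
        _ ≤ z * (1 / 2) ^ (p.1 + 1) * (1 / 2) ^ p.2 := by
            have h1 : 2 * C * z ≤ 1 / 2 := hr
            have h2 : C * z ≤ 1 / 2 := by nlinarith [mul_nonneg hC hz0]
            gcongr
        _ = _ := by ring
  have e1 : ∑' p, f p = RHS a x (U a r x) := by
    rw [hf.tsum_prod, RHS]
    refine tsum_congr fun j => ?_
    change ∑' m, a (j + 1) x * (W a m (1 + (j + 1)) x * r ^ (1 + (j + 1) + m)) = _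
    rw [tsum_mul_left]
    congr 1
    have := (h.hasSum_pow hr hx (j + 1)).tsum_eq
    rw [show 1 + (j + 1) = j + 1 + 1 by omega]
    exact this
  have hf' := hf.hasSum
  rw [e1, ← Finset.HasAntidiagonal.sigmaAntidiagonalEquivProd.hasSum_iff] at hf'
  have := hf'.sigma (g := fun n => DW a n 1 x * r ^ (1 + (n + 1))) (fun n => by
    have := hasSum_fintype (fun p : antidiagonal n => f p)
    convert! this using 1
    rw [Finset.sum_coe_sort (antidiagonal n) f, DW, Finset.sum_mul]
    refine Finset.sum_congr rfl fun p hp => ?_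
    have hp' := Finset.HasAntidiagonal.mem_antidiagonal.1 hp
    simp only [f]
    rw [show 1 + (p.1 + 1) + p.2 = 1 + (n + 1) by omega]
    ring)
  exact this

lemma Nice.rhs_bound (h : Nice C a) (hr : SmallR C T r) (hx : x ∈ Set.Icc 0 T) :
    ‖RHS a x (U a r x)‖ ≤ Real.exp T * ‖r‖ := by
  have hs : HasSum (fun n : ℕ => (Real.exp T * ‖r‖) ^ 1 * (1 / 2 / 2 ^ n : ℝ))
      ((Real.exp T * ‖r‖) ^ 1 * 1) :=
    (hasSum_geometric_two' 1).mul_left _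
  have := tsum_of_norm_bounded hs (f := fun n => DW a n 1 x * r ^ (1 + (n + 1)))
    (fun n => (h.Dterm_bound n 1 hx).trans
      (mul_le_mul_of_nonneg_left ((geo_le h hr (n + 1)).trans_eq (by rw [pow_succ]; simp; ring))
        (by positivity)))
  rw [(h.hasSum_D hr hx).tsum_eq] at this
  linarith

lemma Nice.rhs_int (h : Nice C a) (hr : SmallR C T r) (hT : 0 ≤ T) :
    IntervalIntegrable (fun t => RHS a t (U a r t)) volume 0 T := by
  have hm : AEStronglyMeasurable (fun t => RHS a t (U a r t)) (volume.restrict (Set.uIoc 0 T)) := by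
    refine aestronglyMeasurable_of_tendsto_ae Filter.atTop
      (f := fun N t => ∑ n ∈ Finset.range N, DW a n 1 t * r ^ (1 + (n + 1))) (fun N => ?_) ?_
    · refine Measurable.aestronglyMeasurable ?_
      exact Finset.measurable_fun_sum _ fun n _ => (h.measDW n 1).mul_const _
    · refine (ae_restrict_mem measurableSet_uIoc).mono fun t ht => ?_
      rw [Set.uIoc_of_le hT] at ht
      exact (h.hasSum_D hr ⟨ht.1.le, ht.2⟩).tendsto_sum_nat
  refine IntervalIntegrable.mono_fun (f := fun _ => Real.exp T * ‖r‖) intervalIntegrable_const hm ?_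
  refine (ae_restrict_mem measurableSet_uIoc).mono fun t ht => ?_
  rw [Set.uIoc_of_le hT] at ht
  exact (h.rhs_bound hr ⟨ht.1.le, ht.2⟩).trans (le_abs_self _)

lemma Nice.U_int (h : Nice C a) (hr : SmallR C T r) (hx : x ∈ Set.Icc 0 T) :
    U a r x = r + ∫ t in (0 : ℝ)..x, RHS a t (U a r t) := by
  have hC : 0 ≤ C := zero_le_one.trans h.one_le
  have g1 := summable_geometric_of_lt_one (r := (1 / 2 : ℝ)) (by norm_num) (by norm_num)
  have hs := intervalIntegral.hasSum_integral_of_dominated_convergence (μ := volume) (a := 0) (b := x)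
    (F := fun n t => DW a n 1 t * r ^ (1 + (n + 1))) (f := fun t => RHS a t (U a r t))
    (fun n t => (Real.exp T * ‖r‖) ^ 1 * (1 / 2) ^ (n + 1))
    (fun n => ((h.measDW n 1).mul_const _).aestronglyMeasurable)
    (fun n => Filter.Eventually.of_forall fun t ht => by
      rw [Set.uIoc_of_le hx.1] at ht
      exact (h.Dterm_bound n 1 ⟨ht.1.le, ht.2.trans hx.2⟩).trans
        (mul_le_mul_of_nonneg_left (geo_le h hr (n + 1)) (by positivity)))
    (Filter.Eventually.of_forall fun t ht => ((summable_nat_add_iff 1).2 g1).mul_left _)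
    intervalIntegrable_const
    (Filter.Eventually.of_forall fun t ht => by
      rw [Set.uIoc_of_le hx.1] at ht
      exact h.hasSum_D hr ⟨ht.1.le, ht.2.trans hx.2⟩)
  have hU := h.hasSum_pow hr hx 0
  rw [zero_add, pow_one] at hU
  rw [← hasSum_nat_add_iff' 1] at hU
  simp only [Finset.range_one, Finset.sum_singleton, W_zero, one_mul, add_zero, pow_one] at hU
  have e : (fun n => W a (n + 1) 1 x * r ^ (1 + (n + 1)))
      = fun n => ∫ t in (0 : ℝ)..x, DW a n 1 t * r ^ (1 + (n + 1)) := by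
    ext n
    rw [h.W_succ, intervalIntegral.integral_mul_const]
    simp
  rw [e] at hU
  rw [← hU.unique hs]
  ring

/-- existence -/
lemma Nice.exists_sol (h : Nice C a) (hr : SmallR C T r) (hT : 0 ≤ T) :
    ∃ u : ℝ → ℂ, IsODESol T a u ∧ u 0 = r ∧ (∀ x ∈ Set.Icc 0 T, u x = U a r x) := by
  have hC : 0 ≤ C := zero_le_one.trans h.one_le
  have heq : ∀ x ∈ Set.Icc 0 T, (fun x => r + ∫ t in (0 : ℝ)..x, RHS a t (U a r t)) x = U a r x :=
    fun x hx => (h.U_int hr hx).symm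
  refine ⟨fun x => r + ∫ t in (0 : ℝ)..x, RHS a t (U a r t), ⟨?_, ?_⟩, by simp, heq⟩
  · exact prim_lip r (h.rhs_int hr hT) (fun x hx => h.rhs_bound hr hx) hT
  · rw [ae_restrict_iff' measurableSet_Icc]
    filter_upwards [(h.rhs_int hr hT).ae_hasDerivAt_integral] with x hx hxT
    have e := heq x hxT
    simp only at e
    rw [e]
    constructor
    · apply h.rhs_summ
      have h1 := h.U_bound hr hxT
      have h2 : 2 * C * (Real.exp T * ‖r‖) ≤ 1 / 2 := hr
      nlinarith [mul_le_mul_of_nonneg_left h1 hC]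
    · rw [Set.uIcc_of_le hT] at hx
      exact (hx hxT 0 ⟨le_rfl, hT⟩).const_add r

end series

lemma pow_diff (u v : ℂ) {ρ : ℝ} (hρ : 0 ≤ ρ) (hu : ‖u‖ ≤ ρ) (hv : ‖v‖ ≤ ρ) (n : ℕ) :
    ‖u ^ (n + 1) - v ^ (n + 1)‖ ≤ (n + 1) * ρ ^ n * ‖u - v‖ := by
  induction n with
  | zero => simp
  | succ n ih =>
    have e : u ^ (n + 1 + 1) - v ^ (n + 1 + 1)
        = u * (u ^ (n + 1) - v ^ (n + 1)) + (u - v) * v ^ (n + 1) := by ring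
    rw [e]
    calc _ ≤ ‖u‖ * ‖u ^ (n + 1) - v ^ (n + 1)‖ + ‖u - v‖ * ‖v‖ ^ (n + 1) := by
          refine (norm_add_le _ _).trans ?_
          rw [norm_mul, norm_mul, norm_pow v]
      _ ≤ ρ * ((n + 1) * ρ ^ n * ‖u - v‖) + ‖u - v‖ * ρ ^ (n + 1) := by
          gcongr
      _ = _ := by push_cast; ring

lemma summ_L : Summable fun i : ℕ => ((i : ℝ) + 2) * (1 / 2) ^ (i + 1) := by
  have h1 := summable_pow_mul_geometric_of_norm_lt_one 1 (r := (1 / 2 : ℝ)) (by norm_num)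
  have h2 := summable_geometric_of_lt_one (r := (1 / 2 : ℝ)) (by norm_num) (by norm_num)
  refine ((h1.mul_left (1 / 2)).add h2).congr fun i => ?_
  ring

def LL : ℝ := ∑' i : ℕ, ((i : ℝ) + 2) * (1 / 2) ^ (i + 1)

section uniq
variable {C T : ℝ} {a : ℕ → ℝ → ℂ} {r : ℂ} {x : ℝ}

lemma Nice.rhs_lip (h : Nice C a) {u v : ℂ} (hu : C * ‖u‖ ≤ 1 / 2)
    (hv : C * ‖v‖ ≤ 1 / 2) : ‖RHS a x u - RHS a x v‖ ≤ LL * ‖u - v‖ := by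
  have hC : 0 < C := zero_lt_one.trans_le h.one_le
  rw [RHS, RHS, ← (h.rhs_summ hu).of_norm.tsum_sub (h.rhs_summ hv).of_norm]
  refine tsum_of_norm_bounded (summ_L.hasSum.mul_right ‖u - v‖) fun i => ?_
  rw [← mul_sub, norm_mul]
  have h1 := pow_diff u v (ρ := 1 / (2 * C)) (by positivity)
    (by rw [le_div_iff₀ (by positivity)]; linarith)
    (by rw [le_div_iff₀ (by positivity)]; linarith) (i + 1)
  calc _ ≤ C ^ (i + 1) * (((i + 1 : ℕ) + 1) * (1 / (2 * C)) ^ (i + 1) * ‖u - v‖) := by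
        gcongr
        exact h.bd _ _
    _ = _ := by
        have : C ^ (i + 1) * (1 / (2 * C)) ^ (i + 1) = (1 / 2) ^ (i + 1) := by
          rw [← mul_pow]
          congr 1
          field_simp
        rw [← this]
        push_cast
        ring

lemma Nice.uniq (h : Nice C a) {u v : ℝ → ℂ} (hu : IsODESol T a u) (hv : IsODESol T a v)
    {b y : ℝ} (hb : 0 ≤ b) (hby : b ≤ y) (hy : y ≤ T)
    (hub : ∀ x ∈ Set.Icc b y, C * ‖u x‖ ≤ 1 / 2) (hvb : ∀ x ∈ Set.Icc b y, C * ‖v x‖ ≤ 1 / 2)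
    (h0 : u b = v b) : u y = v y := by
  obtain ⟨⟨K, hK⟩, hu'⟩ := hu
  obtain ⟨⟨K', hK'⟩, hv'⟩ := hv
  have hsub : Set.uIcc b y ⊆ Set.Icc 0 T := by
    rw [Set.uIcc_of_le hby]; exact Set.Icc_subset_Icc hb hy
  have hf : LipschitzOnWith (K + K') (fun x => u x - v x) (Set.uIcc b y) :=
    (hK.mono hsub).sub (hK'.mono hsub)
  have hn : AbsolutelyContinuousOnInterval (fun x => ‖u x - v x‖) b y :=
    (lipschitzWith_one_norm.comp_lipschitzOnWith hf).absolutelyContinuousOnInterval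
  have he : AbsolutelyContinuousOnInterval (fun x => Real.exp (-(2 * LL) * x)) b y := by
    refine ContDiffOn.absolutelyContinuousOnInterval ?_
    exact ContDiff.contDiffOn (by fun_prop)
  set g : ℝ → ℝ := fun x => ‖u x - v x‖ ^ 2 * Real.exp (-(2 * LL) * x) with hg
  have hgac : AbsolutelyContinuousOnInterval g b y := by
    have := (hn.mul hn).mul he
    convert! this using 1
    ext x
    simp [hg, sq]
  have hI := hgac.integral_deriv_eq_sub
  have hle : ∀ᵐ x ∂(volume.restrict (Set.Icc 0 T)), x ∈ Set.Icc b y → deriv g x ≤ 0 := by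
    filter_upwards [hu', hv'] with x hx1 hx2 hx
    have hd := (hx1.2.sub hx2.2).norm_sq.mul
      (((hasDerivAt_id x).const_mul (-(2 * LL))).exp)
    have hL := h.rhs_lip (x := x) (hub x hx) (hvb x hx)
    have e : g = ((fun x => ‖(u - v) x‖ ^ 2) * fun x => Real.exp (-(2 * LL) * id x)) := by
      ext x; simp [hg]
    rw [e, hd.deriv]
    have h1 := real_inner_le_norm (u x - v x) (RHS a x (u x) - RHS a x (v x))
    have h2 : inner ℝ (u x - v x) (RHS a x (u x) - RHS a x (v x)) ≤ LL * ‖u x - v x‖ ^ 2 := by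
      refine h1.trans ?_
      nlinarith [norm_nonneg (u x - v x), mul_le_mul_of_nonneg_left hL (norm_nonneg (u x - v x))]
    have h3 := Real.exp_pos (-(2 * LL) * x)
    have e2 : ∀ A N E : ℝ, 2 * A * E + N ^ 2 * (E * (-(2 * LL) * 1)) = 2 * (A - LL * N ^ 2) * E := by
      intros; ring
    change 2 * inner ℝ (u x - v x) (RHS a x (u x) - RHS a x (v x)) * Real.exp (-(2 * LL) * x)
      + ‖u x - v x‖ ^ 2 * (Real.exp (-(2 * LL) * x) * (-(2 * LL) * 1)) ≤ 0
    rw [e2]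
    nlinarith
  have hle2 : ∫ x in b..y, deriv g x ≤ 0 := by
    rw [intervalIntegral.integral_of_le hby]
    refine integral_nonpos_of_ae ?_
    rw [ae_restrict_iff' measurableSet_Icc] at hle
    rw [Filter.EventuallyLE, ae_restrict_iff' measurableSet_Ioc]
    filter_upwards [hle] with x hx hx'
    exact hx ⟨hb.trans hx'.1.le, hx'.2.trans hy⟩ ⟨hx'.1.le, hx'.2⟩
  rw [hI] at hle2
  have g0 : g b = 0 := by simp [hg, h0]
  rw [g0, sub_zero] at hle2
  have h3 := Real.exp_pos (-(2 * LL) * y)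
  have h4 : ‖u y - v y‖ ^ 2 ≤ 0 := by
    by_contra hcon
    push Not at hcon
    have : 0 < g y := mul_pos hcon h3
    linarith
  have h5 : ‖u y - v y‖ = 0 := by nlinarith [sq_nonneg ‖u y - v y‖, norm_nonneg (u y - v y)]
  exact sub_eq_zero.1 (norm_eq_zero.1 h5)

lemma Nice.sol_eq (h : Nice C a) (hT : 0 ≤ T) {v : ℝ → ℂ} (hv : IsODESol T a v)
    (hr : 2 * C * (Real.exp T * ‖v 0‖) ≤ 1 / 4) : v T = U a (v 0) T := by
  have hC : 0 < C := zero_lt_one.trans_le h.one_le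
  have hr' : SmallR C T (v 0) := hr.trans (by norm_num)
  obtain ⟨u, hu, hu0, huU⟩ := h.exists_sol hr' hT
  have hub : ∀ x ∈ Set.Icc 0 T, C * ‖u x‖ ≤ 1 / 4 := fun x hx => by
    rw [huU x hx]
    have := h.U_bound hr' hx
    nlinarith [mul_le_mul_of_nonneg_left this hC.le]
  have huc : ContinuousOn u (Set.Icc 0 T) := hu.1.choose_spec.continuousOn
  have hvc : ContinuousOn v (Set.Icc 0 T) := hv.1.choose_spec.continuousOn
  have hcl : IsClosed ({x | u x = v x} ∩ Set.Icc 0 T) := by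
    have : {x | u x = v x} ∩ Set.Icc 0 T
        = Set.Icc 0 T ∩ (fun x => u x - v x) ⁻¹' {0} := by
      ext x
      simp [sub_eq_zero, and_comm]
    rw [this]
    exact (huc.sub hvc).preimage_isClosed_of_isClosed isClosed_Icc isClosed_singleton
  have hsub := hcl.Icc_subset_of_forall_exists_gt (by exact hu0) (by
    rintro x ⟨hx, hx0, hxT⟩ y hy
    have hx : u x = v x := hx
    have hy : x < y := hy
    have hcv : ContinuousWithinAt (fun t => C * ‖v t‖) (Set.Icc 0 T) x :=
      ((hvc x ⟨hx0, hxT.le⟩).norm).const_mul C |>.congr (fun _ _ => rfl) rfl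
    have hlt : C * ‖v x‖ < 1 / 2 := by
      rw [← hx]; linarith [hub x ⟨hx0, hxT.le⟩]
    have hev := hcv.eventually (gt_mem_nhds hlt)
    obtain ⟨δ, hδ, hball⟩ := Metric.mem_nhdsWithin_iff.1 hev
    set w := min (min y T) (x + δ / 2) with hw
    have hxw : x < w := by
      rw [hw]; exact lt_min (lt_min hy hxT) (by linarith)
    have hwT : w ≤ T := (min_le_left _ _).trans (min_le_right _ _)
    have hwy : w ≤ y := (min_le_left _ _).trans (min_le_left _ _)
    have hwd : w ≤ x + δ / 2 := min_le_right _ _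
    refine ⟨w, ?_, hxw, hwy⟩
    refine h.uniq hu hv hx0 hxw.le hwT (fun t ht => ?_) (fun t ht => ?_) hx
    · linarith [hub t ⟨hx0.trans ht.1, ht.2.trans hwT⟩]
    · have : t ∈ Metric.ball x δ ∩ Set.Icc 0 T := by
        refine ⟨?_, hx0.trans ht.1, ht.2.trans hwT⟩
        rw [Metric.mem_ball, Real.dist_eq, abs_of_nonneg (by linarith [ht.1])]
        linarith [ht.2]
      exact (hball this).le)
  have : u T = v T := hsub ⟨hT, le_rfl⟩
  rw [← this, huU T ⟨hT, le_rfl⟩]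

lemma coeff_zero (b : ℕ → ℂ) {ε : ℝ} (hε : 0 < ε)
    (hb : ∀ r : ℂ, ‖r‖ < ε → HasSum (fun n => b n * r ^ n) 0) (n : ℕ) : b n = 0 := by
  have hp : HasFPowerSeriesAt (fun _ : ℂ => (0 : ℂ)) (FormalMultilinearSeries.ofScalars ℂ b) 0 := by
    rw [hasFPowerSeriesAt_iff]
    filter_upwards [Metric.ball_mem_nhds (0 : ℂ) hε] with r hr
    have := hb r (by simpa using hr)
    convert! this using 1
    ext n
    simp [mul_comm]
  have h0 := hp.eq_zero
  have := congrArg (fun p => FormalMultilinearSeries.coeff p n) h0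
  simp only [FormalMultilinearSeries.coeff_ofScalars] at this
  rw [this]
  rfl

lemma Nice.center_iff (h : Nice C a) (hT : 0 ≤ T) :
    IsCenter T a ↔ ∀ n, W a (n + 1) 1 T = 0 := by
  have hC : 0 < C := zero_lt_one.trans_le h.one_le
  have hTm : T ∈ Set.Icc 0 T := ⟨hT, le_rfl⟩
  set ε₀ : ℝ := 1 / (8 * C * Real.exp T) with hε₀
  have hε₀p : 0 < ε₀ := by positivity
  have hsm : ∀ r : ℂ, ‖r‖ < ε₀ → 2 * C * (Real.exp T * ‖r‖) ≤ 1 / 4 := fun r hr => by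
    rw [hε₀, lt_div_iff₀ (by positivity)] at hr
    linarith
  constructor
  · rintro ⟨ε, hε, hc⟩ n
    have key := coeff_zero (fun n => if n = 0 then 0 else W a n 1 T) (lt_min hε hε₀p) (by
      intro r hr
      by_cases hr0 : r = 0
      · subst hr0
        convert hasSum_zero using 2 with n
        by_cases hn : n = 0 <;> simp [hn]
      have hr' : SmallR C T r := (hsm r (hr.trans_le (min_le_right _ _))).trans (by norm_num)
      obtain ⟨u, hu, hu0, huU⟩ := h.exists_sol hr' hT
      have h1 := hc u (by rw [hu0]; exact hr.trans_le (min_le_left _ _)) hu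
      rw [huU T hTm, hu0] at h1
      have h2 := h.hasSum_pow hr' hTm 0
      rw [zero_add, pow_one, h1] at h2
      have h3 := (h2.mul_left r⁻¹)
      rw [inv_mul_cancel₀ hr0] at h3
      have h4 := h3.sub (hasSum_ite_eq (0 : ℕ) (1 : ℂ))
      rw [sub_self] at h4
      convert! h4 using 2 with n
      by_cases hn : n = 0
      · subst hn
        simp [W_zero, hr0]
      · simp only [hn, if_false, sub_zero]
        rw [pow_add]
        field_simp
        ) (n + 1)
    simpa using key
  · intro hW
    refine ⟨ε₀, hε₀p, fun v hv0 hv => ?_⟩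
    rw [h.sol_eq hT hv (hsm _ hv0), U, tsum_eq_single 0]
    · simp [W_zero]
    · intro n hn
      obtain ⟨m, rfl⟩ := Nat.exists_eq_succ_of_ne_zero hn
      rw [hW, zero_mul]

lemma Nice.main (h : Nice C a) (hT : 0 ≤ T) :
    IsCenter T a ↔ ∀ i : ℕ, 1 ≤ i →
      ∑ comp : Composition i,
        Polynomial.C (itInt T a comp.blocks) * pPoly comp.blocks = 0 := by
  rw [h.center_iff hT]
  constructor
  · intro hW i hi
    obtain ⟨n, rfl⟩ := Nat.exists_eq_add_of_le' hi
    refine poly_zero_of T a (n + 1) fun s hs => ?_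
    obtain ⟨s, rfl⟩ := Nat.exists_eq_add_of_le' hs
    exact h.W_vanish hT hW s n
  · intro hP n
    have := eval_sum_eq T a (n + 1) 1
    rw [hP (n + 1) (by omega)] at this
    rw [W, ← this]
    simp

end uniq

/-- truncated coefficients -/
def trunc (T : ℝ) (a : ℕ → ℝ → ℂ) (i : ℕ) : ℝ → ℂ :=
  if i = 0 then 0 else Set.indicator (Set.Icc 0 T) (a i)

lemma trunc_eq {T : ℝ} (a : ℕ → ℝ → ℂ) {i : ℕ} (hi : 0 < i) {x : ℝ} (hx : x ∈ Set.Icc 0 T) :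
    trunc T a i x = a i x := by
  rw [trunc, if_neg hi.ne', Set.indicator_of_mem hx]

lemma trunc_nice {T : ℝ} {a : ℕ → ℝ → ℂ} (ha : MemX T a) : ∃ C, Nice C (trunc T a) := by
  obtain ⟨hm, C, hC⟩ := ha
  refine ⟨max |C| 1, le_max_right _ _, fun i => ?_, fun i x => ?_⟩
  · unfold trunc
    split_ifs
    · exact measurable_const
    · exact (hm i).indicator measurableSet_Icc
  · have h1 : (0 : ℝ) ≤ max |C| 1 := zero_le_one.trans (le_max_right _ _)
    rcases Nat.eq_zero_or_pos i with rfl | hi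
    · simp [trunc]
    · by_cases hx : x ∈ Set.Icc 0 T
      · rw [trunc_eq a hi hx]
        refine (hC i hi x hx).trans ((le_abs_self _).trans ?_)
        rw [abs_pow]
        exact pow_le_pow_left₀ (abs_nonneg _) (le_max_left _ _) _
      · rw [trunc, if_neg hi.ne', Set.indicator_of_notMem hx]
        simp only [norm_zero]
        positivity

lemma trunc_itInt {T : ℝ} (a : ℕ → ℝ → ℂ) (l : List ℕ) (hl : ∀ i ∈ l, 0 < i) :
    ∀ x ∈ Set.Icc 0 T, itIntAux (trunc T a) l x = itIntAux a l x := by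
  induction l with
  | nil => intro x _; rfl
  | cons i l ih =>
    intro x hx
    rw [itIntAux, itIntAux]
    refine intervalIntegral.integral_congr fun t ht => ?_
    rw [Set.uIcc_of_le hx.1] at ht
    have ht' : t ∈ Set.Icc 0 T := ⟨ht.1, ht.2.trans hx.2⟩
    rw [trunc_eq a (hl i (by simp)) ht', ih (fun j hj => hl j (by simp [hj])) t ht']

lemma trunc_sol {T : ℝ} (a : ℕ → ℝ → ℂ) (v : ℝ → ℂ) :
    IsODESol T (trunc T a) v ↔ IsODESol T a v := by
  unfold IsODESol
  refine and_congr Iff.rfl ?_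
  rw [ae_restrict_iff' measurableSet_Icc, ae_restrict_iff' measurableSet_Icc]
  refine Filter.eventually_congr (Filter.Eventually.of_forall fun x => ?_)
  refine imp_congr_right fun hx => ?_
  simp_rw [fun i : ℕ => trunc_eq a (Nat.succ_pos i) hx]

/-- center criterion, polynomial form: `a ∈ X` determines a center iff for
every `i ≥ 1` the polynomial `∑_{i₁+⋯+iₖ=i} p_{i₁,…,iₖ} · I_{i₁,…,iₖ}(a)` is identically
zero in `ℂ[t]`; the sum is over all compositions of `i`. -/
theorem center_iff_polynomial (T : ℝ) (hT : 0 < T) (a : ℕ → ℝ → ℂ) (ha : MemX T a) :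
    IsCenter T a ↔ ∀ i : ℕ, 1 ≤ i →
      ∑ comp : Composition i,
        Polynomial.C (itInt T a comp.blocks) * pPoly comp.blocks = 0 := by
  obtain ⟨C, h⟩ := trunc_nice ha
  have key := h.main hT.le
  have e1 : IsCenter T (trunc T a) ↔ IsCenter T a := by
    unfold IsCenter
    simp_rw [trunc_sol]
  rw [← e1, key]
  refine forall_congr' fun i => imp_congr_right fun _ => ?_
  have e2 : ∀ c : Composition i, itInt T (trunc T a) c.blocks = itInt T a c.blocks := fun c => by
    unfold itInt
    exact trunc_itInt a _ (fun j hj => c.blocks_pos (List.mem_reverse.1 hj)) T ⟨hT.le, le_rfl⟩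
  simp_rw [e2]
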